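/- arXiv:0708.0511 — 3 statements merged into one kernel-verified Lean document; each statement's English description precedes it below -/
import Mathlib

section
/- (Quantum homological equation.) Let s' ≥ 3 and W ∈ 𝒲^{s'}. Let (A_t)_{t≥0} be a family with A_t ∈ 𝒲^t for all t (and A_t := 0 for t < 0), and assume A₁ = 0. For s ≥ 0 define A'_s := Σ_{k=0}^{⌊s/(s'−2)⌋} (1/k!)·(Mad_W)^k A_{s−k(s'−2)}. Then the term of order s' satisfies A'_{s'} = A_{s'} − {A₂, W}, where {·,·} is the Poisson bracket (so the Moyal correction terms do not contribute at order s'). -/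
open MvPolynomial

/-- Variables of the polynomial ring `R = ℂ[ħ, q₁, …, q_d, p₁, …, p_d]`:
`PVar.h` is `ħ`, `PVar.q k` is `q_k` and `PVar.p k` is `p_k`. -/
inductive PVar (d : ℕ) : Type where
  | h : PVar d
  | q : Fin d → PVar d
  | p : Fin d → PVar d
  deriving DecidableEq

/-- The commutative polynomial ring `R = ℂ[ħ, q₁, …, q_d, p₁, …, p_d]`. -/
abbrev Rpoly (d : ℕ) : Type := MvPolynomial (PVar d) ℂ

/-- `ħ` as an element of `R`. -/
noncomputable def hbar (d : ℕ) : Rpoly d := X PVar.h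

/-- The formal partial derivative with respect to a variable, as a linear endomorphism. -/
noncomputable def pd {d : ℕ} (v : PVar d) : Module.End ℂ (Rpoly d) :=
  (pderiv v).toLinearMap

/-- Iterated partial derivative `∂^μ` with respect to the family of variables `f`. -/
noncomputable def pdMulti {d : ℕ} (f : Fin d → PVar d) (μ : Fin d → ℕ) :
    Module.End ℂ (Rpoly d) :=
  (List.ofFn fun k => pd (f k) ^ μ k).prod

/-- The bidifferential operator
`P^n(A,B) = Σ_{μ,ν ∈ ℕ^d, |μ|+|ν|=n} (n!/(μ!·ν!)) (−1)^{|ν|} (∂_q^μ ∂_p^ν A)·(∂_p^μ ∂_q^ν B)`.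
(Any multi-index contributing to the sum has all entries `≤ n`, so the sum below over
`μ ν : Fin d → Fin (n+1)` captures exactly the nonzero part of this sum.) -/
noncomputable def Pop {d : ℕ} (n : ℕ) (A B : Rpoly d) : Rpoly d :=
  ∑ μ : Fin d → Fin (n + 1), ∑ ν : Fin d → Fin (n + 1),
    if (∑ k, (μ k : ℕ)) + (∑ k, (ν k : ℕ)) = n then
      C (((n.factorial : ℂ) /
            (((∏ k, Nat.factorial (μ k)) * ∏ k, Nat.factorial (ν k) : ℕ) : ℂ)) *
          (-1 : ℂ) ^ (∑ k, (ν k : ℕ))) *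
        pdMulti PVar.q (fun k => (μ k : ℕ)) (pdMulti PVar.p (fun k => (ν k : ℕ)) A) *
        pdMulti PVar.p (fun k => (μ k : ℕ)) (pdMulti PVar.q (fun k => (ν k : ℕ)) B)
    else 0

/-- The Poisson bracket `{A,B} = P^1(A,B) = Σ_k (∂_{q_k}A·∂_{p_k}B − ∂_{p_k}A·∂_{q_k}B)`. -/
noncomputable def poisson {d : ℕ} (A B : Rpoly d) : Rpoly d :=
  ∑ k : Fin d, (pd (PVar.q k) A * pd (PVar.p k) B - pd (PVar.p k) A * pd (PVar.q k) B)

/-- The Moyal bracket `{A,B}_M = Σ_{k≥0} ((−1)^k (ħ/2)^{2k}/(2k+1)!) P^{2k+1}(A,B)`.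
On polynomials this series is a finite sum: all terms with `2k+1` exceeding the total
degree vanish, so the truncation below equals the full series. -/
noncomputable def moyal {d : ℕ} (A B : Rpoly d) : Rpoly d :=
  ∑ k ∈ Finset.range (A.totalDegree + B.totalDegree + 1),
    C ((-1 : ℂ) ^ k / ((2 * k + 1).factorial : ℂ)) *
      (C (1 / 2 : ℂ) * hbar d) ^ (2 * k) * Pop (2 * k + 1) A B

/-- The Moyal star product `A⋆B = Σ_{k≥0} (1/k!)(iħ/2)^k P^k(A,B)`.
On polynomials this series is a finite sum: all terms with `k` exceeding the total
degree vanish, so the truncation below equals the full series. -/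
noncomputable def starP {d : ℕ} (A B : Rpoly d) : Rpoly d :=
  ∑ k ∈ Finset.range (A.totalDegree + B.totalDegree + 1),
    C ((k.factorial : ℂ))⁻¹ * (C (Complex.I / 2) * hbar d) ^ k * Pop k A B

/-- The Moyal adjoint `Mad_W A = {W,A}_M`. -/
noncomputable def Mad {d : ℕ} (W A : Rpoly d) : Rpoly d := moyal W A

/-- The weight of a variable: `q_k, p_k` have weight 1, `ħ` has weight 2. -/
def wtv {d : ℕ} : PVar d → ℕ
  | .h => 2
  | .q _ => 1
  | .p _ => 1

/-- The weight `2j + |α| + |β|` of a monomial `ħ^j q^α p^β` with exponent data `m`. -/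
def wt {d : ℕ} (m : PVar d →₀ ℕ) : ℕ := m.sum fun v e => wtv v * e

/-- The space `𝒲^s`: the ℂ-linear span of the monomials `ħ^j q^α p^β` with
`2j+|α|+|β| = s`; it is `{0}` for `s < 0`. -/
noncomputable def Wgr (d : ℕ) (s : ℤ) : Submodule ℂ (Rpoly d) :=
  Submodule.span ℂ {P : Rpoly d | ∃ m : PVar d →₀ ℕ, (wt m : ℤ) = s ∧ P = monomial m 1}

theorem wt_add {d : ℕ} (m n : PVar d →₀ ℕ) : wt (m + n) = wt m + wt n :=
  Finsupp.sum_add_index' (fun _ => by simp) (fun _ _ _ => by ring)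

theorem wt_single {d : ℕ} (v : PVar d) (e : ℕ) : wt (Finsupp.single v e) = wtv v * e := by
  simp [wt]

theorem Wgr_eq_bot_of_neg {d : ℕ} {s : ℤ} (hs : s < 0) : Wgr d s = ⊥ := by
  rw [Wgr, Submodule.span_eq_bot]
  rintro _ ⟨m, hm, -⟩
  omega

/-- Differentiation with respect to `v` lowers the weight by the weight of `v`. -/
theorem pd_mem_Wgr {d : ℕ} (v : PVar d) {s : ℤ} {A : Rpoly d} (hA : A ∈ Wgr d s) :
    pd v A ∈ Wgr d (s - wtv v) := by
  induction hA using Submodule.span_induction with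
  | zero => simp
  | add x y _ _ hx hy => rw [map_add]; exact add_mem hx hy
  | smul a x _ hx => rw [map_smul]; exact Submodule.smul_mem _ _ hx
  | mem x hx =>
    obtain ⟨m, hm, rfl⟩ := hx
    have hpd : pd v (monomial m (1 : ℂ)) =
        (m v : ℂ) • monomial (m - Finsupp.single v 1) (1 : ℂ) := by
      simp [pd, pderiv_monomial, smul_monomial]
    rw [hpd]
    by_cases h0 : m v = 0
    · simp [h0]
    refine Submodule.smul_mem _ _ (Submodule.subset_span ⟨_, ?_, rfl⟩)
    have hle : Finsupp.single v 1 ≤ m := by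
      rw [Finsupp.single_le_iff]
      omega
    have hw := wt_add (m - Finsupp.single v 1) (Finsupp.single v 1)
    rw [tsub_add_cancel_of_le hle, wt_single] at hw
    omega

theorem pd_pow_mem_Wgr {d : ℕ} (v : PVar d) (n : ℕ) {s : ℤ} {A : Rpoly d} (hA : A ∈ Wgr d s) :
    (pd v ^ n) A ∈ Wgr d (s - wtv v * n) := by
  induction n with
  | zero => simpa using hA
  | succ n ih =>
    rw [pow_succ', Module.End.mul_apply]
    convert pd_mem_Wgr v ih using 2
    push_cast
    ring

theorem pdMulti_mem_Wgr {d : ℕ} {f : Fin d → PVar d} (hf : ∀ k, wtv (f k) = 1) (μ : Fin d → ℕ)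
    {s : ℤ} {A : Rpoly d} (hA : A ∈ Wgr d s) :
    pdMulti f μ A ∈ Wgr d (s - ((∑ k, μ k : ℕ) : ℤ)) := by
  have key (l : List (Fin d)) :
      (l.map fun k => pd (f k) ^ μ k).prod A ∈ Wgr d (s - ((l.map μ).sum : ℕ)) := by
    induction l with
    | nil => simpa using hA
    | cons k l ih =>
      rw [List.map_cons (f := fun k => pd (f k) ^ μ k), List.prod_cons, Module.End.mul_apply]
      convert pd_pow_mem_Wgr (f k) (μ k) ih using 2
      rw [List.map_cons, List.sum_cons, hf]
      push_cast
      ring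
  rw [pdMulti, List.ofFn_eq_map, ← List.sum_ofFn, List.ofFn_eq_map]
  exact key _

theorem pdMulti_zero {d : ℕ} (f : Fin d → PVar d) : pdMulti f (fun _ => 0) = 1 := by
  simp [pdMulti]

theorem pdMulti_single {d : ℕ} (f : Fin d → PVar d) (k : Fin d) :
    pdMulti f (fun j => if j = k then 1 else 0) = pd (f k) := by
  rw [pdMulti, List.ofFn_eq_map,
    List.prod_map_eq_pow_single (a := k) (fun j => pd (f j) ^ (if j = k then 1 else 0))
      (fun j hj _ => by simp [hj])]
  simp

/-- `P^n(A, B)` vanishes as soon as `n` exceeds the weight of `B`. -/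
theorem Pop_eq_zero_of_lt {d : ℕ} {n : ℕ} {t : ℤ} (ht : t < n) (A : Rpoly d) {B : Rpoly d}
    (hB : B ∈ Wgr d t) : Pop n A B = 0 := by
  refine Finset.sum_eq_zero fun μ _ => Finset.sum_eq_zero fun ν _ => ?_
  split_ifs with h
  · have hmem := pdMulti_mem_Wgr (f := PVar.p) (fun _ => rfl) (fun k => (μ k : ℕ))
      (pdMulti_mem_Wgr (f := PVar.q) (fun _ => rfl) (fun k => (ν k : ℕ)) hB)
    rw [Wgr_eq_bot_of_neg (by omega), Submodule.mem_bot] at hmem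
    rw [hmem, mul_zero]
  · rfl

theorem sum_val_eq_zero_iff {ι : Type*} [Fintype ι] (μ : ι → Fin 2) :
    ∑ k, (μ k : ℕ) = 0 ↔ μ = 0 := by
  rw [Finset.sum_eq_zero_iff, funext_iff]
  exact ⟨fun h k => Fin.ext (h k (Finset.mem_univ k)), fun h k _ => congrArg Fin.val (h k)⟩

theorem sum_val_eq_one_iff {ι : Type*} [Fintype ι] [DecidableEq ι] (μ : ι → Fin 2) :
    ∑ k, (μ k : ℕ) = 1 ↔ ∃ k, μ = Pi.single k 1 := by
  constructor
  · intro h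
    obtain ⟨k, hk⟩ := (Finsupp.sum_eq_one_iff
      (Finsupp.equivFunOnFinite.symm fun k => (μ k : ℕ))).1 (by
        rw [Finsupp.sum_fintype _ _ (fun _ => rfl)]
        simpa using h)
    refine ⟨k, funext fun j => Fin.ext ?_⟩
    have hj := DFunLike.congr_fun hk j
    rw [Finsupp.equivFunOnFinite_symm_apply_apply, Finsupp.single_apply] at hj
    rw [hj, Pi.single_apply]
    by_cases hjk : j = k <;> simp [hjk, Ne.symm]
  · rintro ⟨k, rfl⟩
    rw [Finset.sum_eq_single k] <;> simp +contextual

theorem sum_ite_sum_val_eq_one {ι M : Type*} [Fintype ι] [DecidableEq ι] [AddCommMonoid M]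
    (F : (ι → Fin 2) → M) :
    ∑ μ : ι → Fin 2, (if ∑ k, (μ k : ℕ) = 1 then F μ else 0) = ∑ k, F (Pi.single k 1) := by
  have himage : Finset.univ.filter (fun μ : ι → Fin 2 => ∑ k, (μ k : ℕ) = 1) =
      Finset.univ.image fun k => Pi.single k 1 := by
    ext μ
    simp [sum_val_eq_one_iff, eq_comm (b := μ)]
  rw [← Finset.sum_filter, himage, Finset.sum_image]
  intro i _ j _ hij
  by_contra hne
  simpa [hne] using congrFun hij i

theorem val_single {ι : Type*} [DecidableEq ι] (k j : ι) :
    (((Pi.single k 1 : ι → Fin 2) j : Fin 2) : ℕ) = if j = k then 1 else 0 := by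
  rw [Pi.single_apply]
  split_ifs <;> rfl

theorem Pop_one {d : ℕ} (A B : Rpoly d) : Pop 1 A B = poisson A B := by
  have hsplit (F : (Fin d → Fin 2) → (Fin d → Fin 2) → Rpoly d) :
      ∑ μ, ∑ ν, (if (∑ k, (μ k : ℕ)) + (∑ k, (ν k : ℕ)) = 1 then F μ ν else 0) =
        ∑ k, (F (Pi.single k 1) 0 + F 0 (Pi.single k 1)) := by
    have hterm (μ ν : Fin d → Fin 2) :
        (if (∑ k, (μ k : ℕ)) + (∑ k, (ν k : ℕ)) = 1 then F μ ν else 0) =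
          (if ν = 0 then (if ∑ k, (μ k : ℕ) = 1 then F μ ν else 0) else 0) +
            (if μ = 0 then (if ∑ k, (ν k : ℕ) = 1 then F μ ν else 0) else 0) := by
      simp_rw [← sum_val_eq_zero_iff]
      split_ifs <;> first | omega | simp
    simp_rw [hterm, Finset.sum_add_distrib]
    congr 1
    · simp [sum_ite_sum_val_eq_one]
    · rw [Finset.sum_comm]
      simp [sum_ite_sum_val_eq_one]
  rw [Pop, hsplit, poisson]
  refine Finset.sum_congr rfl fun k _ => ?_
  simp [val_single, pdMulti_single, pdMulti_zero, apply_ite Nat.factorial, sub_eq_add_neg]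

theorem poisson_antisymm {d : ℕ} (A B : Rpoly d) : poisson A B = -poisson B A := by
  rw [poisson, poisson, ← Finset.sum_neg_distrib]
  exact Finset.sum_congr rfl fun k _ => by ring

/-- On elements of weight at most two, the Moyal bracket reduces to the Poisson bracket. -/
theorem moyal_eq_poisson {d : ℕ} (W : Rpoly d) {t : ℤ} (ht : t ≤ 2) {B : Rpoly d}
    (hB : B ∈ Wgr d t) : moyal W B = poisson W B := by
  rw [moyal, Finset.sum_eq_single 0]
  · simp [Pop_one]
  · intro k _ hk
    rw [Pop_eq_zero_of_lt (by push_cast; omega) W hB, mul_zero]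
  · simp

theorem Mad_eq_zero_of_mem_Wgr_zero {d : ℕ} (W : Rpoly d) {B : Rpoly d} (hB : B ∈ Wgr d 0) :
    Mad W B = 0 := by
  rw [Mad, moyal_eq_poisson W (by norm_num) hB, ← Pop_one, Pop_eq_zero_of_lt (by norm_num) W hB]

theorem iterate_Mad_eq_zero {d : ℕ} (W : Rpoly d) {B : Rpoly d} (hB : B ∈ Wgr d 0) {k : ℕ}
    (hk : k ≠ 0) : (Mad W)^[k] B = 0 := by
  obtain ⟨k, rfl⟩ := Nat.exists_eq_succ_of_ne_zero hk
  rw [Function.iterate_succ_apply, Mad_eq_zero_of_mem_Wgr_zero W hB]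
  exact Function.iterate_fixed (Mad_eq_zero_of_mem_Wgr_zero W (zero_mem _)) k

/-- Quantum homological equation. Let `s' ≥ 3` and `W ∈ 𝒲^{s'}`.
Let `(A_t)_{t≥0}` be a family with `A_t ∈ 𝒲^t` for all `t` and `A₁ = 0`. For `s ≥ 0`
set `A'_s := Σ_{k=0}^{⌊s/(s'−2)⌋} (1/k!)·(Mad_W)^k A_{s−k(s'−2)}` (no negative indices
occur, since `k(s'−2) ≤ s` throughout the sum). Then the term of order `s'` satisfies
`A'_{s'} = A_{s'} − {A₂, W}`, with `{·,·}` the Poisson bracket. -/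
theorem quantum_homological_equation {d : ℕ} (s' : ℕ) (hs' : 3 ≤ s')
    (W : Rpoly d) (hW : W ∈ Wgr d (s' : ℤ))
    (A : ℕ → Rpoly d) (hA : ∀ t : ℕ, A t ∈ Wgr d (t : ℤ)) (hA1 : A 1 = 0) :
    ∑ k ∈ Finset.range (s' / (s' - 2) + 1),
        ((k.factorial : ℂ))⁻¹ • (Mad W)^[k] (A (s' - k * (s' - 2))) =
      A s' - poisson (A 2) W := by
  have hsum : ∑ k ∈ Finset.range (s' / (s' - 2) + 1),
        ((k.factorial : ℂ))⁻¹ • (Mad W)^[k] (A (s' - k * (s' - 2))) =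
      ∑ k ∈ Finset.range 2, ((k.factorial : ℂ))⁻¹ • (Mad W)^[k] (A (s' - k * (s' - 2))) := by
    have hdiv : 1 ≤ s' / (s' - 2) := (Nat.one_le_div_iff (by omega)).2 (by omega)
    refine (Finset.sum_subset (Finset.range_mono (by omega)) fun k _ hk => ?_).symm
    have hk2 : 2 ≤ k := by simpa [Nat.succ_le_iff] using hk
    have hle : 2 * (s' - 2) ≤ k * (s' - 2) := Nat.mul_le_mul_right _ hk2
    have hmem : A (s' - k * (s' - 2)) ∈ Wgr d 0 := by
      have hcases : s' - k * (s' - 2) = 0 ∨ s' - k * (s' - 2) = 1 := by omega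
      rcases hcases with h | h
      · simpa [h] using hA 0
      · rw [h, hA1]
        exact zero_mem _
    rw [iterate_Mad_eq_zero W hmem (by omega), smul_zero]
  have hA2 : Mad W (A 2) = -poisson (A 2) W := by
    rw [Mad, moyal_eq_poisson W le_rfl (hA 2), poisson_antisymm]
  have hidx : s' - (s' - 2) = 2 := by omega
  rw [hsum]
  simp [Finset.sum_range_succ, hidx, hA2, sub_eq_add_neg]
end

section
/- (Kernel–image decomposition.) Let λ, ω₂, …, ω_d ∈ ℝ, H₂ := λ·x₁ξ₁ + i·Σ_{k=2}^d ω_k·x_k ξ_k, and 𝒟 := {H₂, ·}. Then for every n ∈ ℕ, 𝒟 maps 𝒲^n into 𝒲^n and 𝒲^n decomposes as the internal direct sum 𝒲^n = Ker(𝒟|_{𝒲^n}) ⊕ Im(𝒟|_{𝒟^n restricted to 𝒲^n}), i.e. Ker(𝒟|_{𝒲^n}) ∩ Im(𝒟|_{𝒲^n}) = {0} and Ker(𝒟|_{𝒲^n}) + Im(𝒟|_{𝒲^n}) = 𝒲^n. -/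
open MvPolynomial

/-- The quadratic part `H₂ = λ·x₁ξ₁ + i·Σ_{k=2}^d ω_k·x_k ξ_k` at a nonresonant
saddle-centre-⋯-centre equilibrium point, written in the complexified coordinates.
Here the polynomial ring has `d+1` degrees of freedom: `PVar.q k` plays the role of
`x_{k+1}` and `PVar.p k` the role of `ξ_{k+1}`; the saddle variable has index `0` and
the `d` centre frequencies are `ω i`, `i : Fin d`. -/
noncomputable def H2saddle (d : ℕ) (lam : ℝ) (ω : Fin d → ℝ) : Rpoly (d + 1) :=
  C (lam : ℂ) * X (PVar.q 0) * X (PVar.p 0) +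
    ∑ i : Fin d, C (Complex.I * (ω i : ℂ)) * X (PVar.q i.succ) * X (PVar.p i.succ)

/-- The monomial `ħ^j x^α ξ^β`. -/
noncomputable def mono (d : ℕ) (j : ℕ) (α β : Fin (d + 1) → ℕ) : Rpoly (d + 1) :=
  hbar (d + 1) ^ j * (∏ k, X (PVar.q k) ^ α k) * ∏ k, X (PVar.p k) ^ β k

theorem coeff_X_mul_pderiv {σ R : Type*} [CommSemiring R] (v : σ) (A : MvPolynomial σ R)
    (m : σ →₀ ℕ) : coeff m (X v * pderiv v A) = (m v : R) * coeff m A := by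
  classical
  induction A using MvPolynomial.induction_on' with
  | monomial u a =>
    rw [X_mul_pderiv_monomial, coeff_smul, coeff_monomial]
    split_ifs with h
    · subst h
      simp
    · simp
  | add p q hp hq => rw [map_add, mul_add, coeff_add, hp, hq, coeff_add, mul_add]

/-- The coefficient of `q_k p_k` in `H₂`. -/
noncomputable def freq (d : ℕ) (lam : ℝ) (ω : Fin d → ℝ) : Fin (d + 1) → ℂ :=
  Fin.cons (lam : ℂ) fun i => Complex.I * (ω i : ℂ)

/-- The eigenvalue of `{H₂, ·}` on the monomial with exponent data `m`. -/
noncomputable def eigenvalue (d : ℕ) (lam : ℝ) (ω : Fin d → ℝ) (m : PVar (d + 1) →₀ ℕ) : ℂ :=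
  ∑ k, freq d lam ω k * ((m (PVar.p k) : ℂ) - (m (PVar.q k) : ℂ))

theorem H2saddle_eq_sum (d : ℕ) (lam : ℝ) (ω : Fin d → ℝ) :
    H2saddle d lam ω = ∑ k, C (freq d lam ω k) * X (PVar.q k) * X (PVar.p k) := by
  simp [H2saddle, freq, Fin.sum_univ_succ]

theorem pd_q_H2saddle (d : ℕ) (lam : ℝ) (ω : Fin d → ℝ) (k : Fin (d + 1)) :
    pd (PVar.q k) (H2saddle d lam ω) = C (freq d lam ω k) * X (PVar.p k) := by
  simp [H2saddle_eq_sum, pd, Derivation.leibniz, pderiv_X, Pi.single_apply, mul_comm]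

theorem pd_p_H2saddle (d : ℕ) (lam : ℝ) (ω : Fin d → ℝ) (k : Fin (d + 1)) :
    pd (PVar.p k) (H2saddle d lam ω) = C (freq d lam ω k) * X (PVar.q k) := by
  simp [H2saddle_eq_sum, pd, Derivation.leibniz, pderiv_X, Pi.single_apply]

theorem coeff_poisson_H2saddle (d : ℕ) (lam : ℝ) (ω : Fin d → ℝ) (A : Rpoly (d + 1))
    (m : PVar (d + 1) →₀ ℕ) :
    coeff m (poisson (H2saddle d lam ω) A) = eigenvalue d lam ω m * coeff m A := by
  rw [poisson, coeff_sum, eigenvalue, Finset.sum_mul]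
  refine Finset.sum_congr rfl fun k _ => ?_
  rw [pd_q_H2saddle, pd_p_H2saddle, coeff_sub, mul_assoc, mul_assoc, coeff_C_mul, coeff_C_mul]
  simp only [pd, Derivation.coeFn_coe, coeff_X_mul_pderiv]
  ring

theorem mem_Wgr_iff {d : ℕ} {s : ℤ} {A : Rpoly d} :
    A ∈ Wgr d s ↔ ∀ m, coeff m A ≠ 0 → (wt m : ℤ) = s := by
  classical
  constructor
  · intro h
    induction h using Submodule.span_induction with
    | mem P hP =>
      obtain ⟨u, hu, rfl⟩ := hP
      intro m hm
      rw [coeff_monomial] at hm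
      split_ifs at hm with h
      · exact h ▸ hu
      · exact absurd rfl hm
    | zero => simp
    | add P Q _ _ hP hQ =>
      intro m hm
      by_cases h : coeff m P = 0
      · exact hQ m (by simpa [h] using hm)
      · exact hP m h
    | smul c P _ hP =>
      intro m hm
      exact hP m fun h => hm (by simp [h])
  · intro h
    rw [A.as_sum]
    refine Submodule.sum_mem _ fun m hm => ?_
    have : monomial m (coeff m A) = coeff m A • (monomial m 1 : Rpoly d) := by
      simp [smul_monomial]
    rw [this]
    exact Submodule.smul_mem _ _ (Submodule.subset_span ⟨m, h m (mem_support_iff.mp hm), rfl⟩)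

theorem exists_coeff_eq_mul {σ R : Type*} [CommSemiring R] (c : (σ →₀ ℕ) → R)
    (A : MvPolynomial σ R) : ∃ B : MvPolynomial σ R, ∀ m, coeff m B = c m * coeff m A := by
  classical
  refine ⟨∑ m ∈ A.support, monomial m (c m * coeff m A), fun m => ?_⟩
  by_cases h : coeff m A = 0 <;> simp [coeff_sum, coeff_monomial, h]

theorem mem_Wgr_of_coeff_eq_mul {d : ℕ} {s : ℤ} {A B : Rpoly d} {c : (PVar d →₀ ℕ) → ℂ}
    (hA : A ∈ Wgr d s) (hB : ∀ m, coeff m B = c m * coeff m A) : B ∈ Wgr d s :=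
  mem_Wgr_iff.mpr fun m hm => mem_Wgr_iff.mp hA m fun h => hm (by rw [hB, h, mul_zero])

/-- Kernel–image decomposition. For every `n`, the operator
`𝒟 = {H₂,·}` maps `𝒲^n` into `𝒲^n`, and `𝒲^n` is the internal direct sum of the
kernel and the image of `𝒟` restricted to `𝒲^n`: the kernel and image intersect
trivially, and together they span `𝒲^n`. -/
theorem kernel_image_decomposition (d : ℕ) (lam : ℝ) (ω : Fin d → ℝ) (n : ℕ) :
    (∀ A ∈ Wgr (d + 1) (n : ℤ),
        poisson (H2saddle d lam ω) A ∈ Wgr (d + 1) (n : ℤ)) ∧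
    (∀ A ∈ Wgr (d + 1) (n : ℤ), poisson (H2saddle d lam ω) A = 0 →
        (∃ B ∈ Wgr (d + 1) (n : ℤ), poisson (H2saddle d lam ω) B = A) → A = 0) ∧
    (∀ A ∈ Wgr (d + 1) (n : ℤ), ∃ A₁ ∈ Wgr (d + 1) (n : ℤ), ∃ A₂ ∈ Wgr (d + 1) (n : ℤ),
        poisson (H2saddle d lam ω) A₁ = 0 ∧
        (∃ B ∈ Wgr (d + 1) (n : ℤ), poisson (H2saddle d lam ω) B = A₂) ∧
        A = A₁ + A₂) := by
  have hD {A : Rpoly (d + 1)} (hA : A ∈ Wgr (d + 1) (n : ℤ)) :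
      poisson (H2saddle d lam ω) A ∈ Wgr (d + 1) (n : ℤ) :=
    mem_Wgr_of_coeff_eq_mul hA (coeff_poisson_H2saddle d lam ω A)
  refine ⟨fun A hA => hD hA, ?_, fun A hA => ?_⟩
  · rintro _ - h ⟨B, -, rfl⟩
    ext m
    have hm := congrArg (coeff m) h
    simp only [coeff_poisson_H2saddle, coeff_zero] at hm ⊢
    rcases mul_eq_zero.mp hm with h0 | h0
    · rw [h0, zero_mul]
    · exact h0
  · obtain ⟨B, hB⟩ := exists_coeff_eq_mul (fun m => (eigenvalue d lam ω m)⁻¹) A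
    have hBW := mem_Wgr_of_coeff_eq_mul hA hB
    refine ⟨A - poisson (H2saddle d lam ω) B, Submodule.sub_mem _ hA (hD hBW),
      poisson (H2saddle d lam ω) B, hD hBW, ?_, ⟨B, hBW, rfl⟩, (sub_add_cancel _ _).symm⟩
    ext m
    simp only [coeff_poisson_H2saddle, coeff_sub, hB, coeff_zero]
    by_cases h : eigenvalue d lam ω m = 0
    · rw [h, zero_mul]
    · rw [mul_inv_cancel_left₀ h, sub_self, mul_zero]
end

section
/- (Star-product recursion for the saddle integral.) Let d = 1 and I := p·q ∈ R. Then for every n ≥ 1, I ⋆ Iⁿ = I^{n+1} + (ħ/2)²·n²·I^{n−1}. -/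
open MvPolynomial

/-- The classical integral `I = p·q` for one degree of freedom. -/
noncomputable def Isad : Rpoly 1 := X (PVar.p 0) * X (PVar.q 0)

theorem pdMulti_one_dim (f : Fin 1 → PVar 1) (μ : Fin 1 → ℕ) :
    pdMulti f μ = pd (f 0) ^ μ 0 := by
  simp [pdMulti]

/-- In one degree of freedom, `P^n` is a sum over pairs `(μ, ν)` with `μ + ν = n`. -/
theorem Pop_one_dim (n : ℕ) (A B : Rpoly 1) :
    Pop n A B = ∑ x ∈ Finset.HasAntidiagonal.antidiagonal n,
      C ((n.factorial : ℂ) / ((x.1.factorial * x.2.factorial : ℕ) : ℂ) * (-1 : ℂ) ^ x.2) *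
        (pd (PVar.q 0) ^ x.1) ((pd (PVar.p 0) ^ x.2) A) *
        (pd (PVar.p 0) ^ x.1) ((pd (PVar.q 0) ^ x.2) B) := by
  set F : ℕ → ℕ → Rpoly 1 := fun a b =>
    C ((n.factorial : ℂ) / ((a.factorial * b.factorial : ℕ) : ℂ) * (-1 : ℂ) ^ b) *
      (pd (PVar.q 0) ^ a) ((pd (PVar.p 0) ^ b) A) *
      (pd (PVar.p 0) ^ a) ((pd (PVar.q 0) ^ b) B) with hF
  calc Pop n A B
      = ∑ μ : Fin 1 → Fin (n + 1), ∑ ν : Fin 1 → Fin (n + 1),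
          if (μ 0 : ℕ) + (ν 0 : ℕ) = n then F (μ 0) (ν 0) else 0 := by
        simp only [Pop, pdMulti_one_dim, Fin.sum_univ_one, Fin.prod_univ_one, hF]
    _ = ∑ a : Fin (n + 1), ∑ b : Fin (n + 1),
          if (a : ℕ) + (b : ℕ) = n then F a b else 0 :=
        Fintype.sum_equiv (Equiv.funUnique (Fin 1) (Fin (n + 1))) _ _ fun _ =>
          Fintype.sum_equiv (Equiv.funUnique (Fin 1) (Fin (n + 1))) _ _ fun _ => rfl
    _ = ∑ a ∈ Finset.range (n + 1), ∑ b ∈ Finset.range (n + 1),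
          if a + b = n then F a b else 0 := by
        simp only [Finset.sum_range]
    _ = ∑ a ∈ Finset.range (n + 1), F a (n - a) := by
        refine Finset.sum_congr rfl fun a ha => ?_
        have ha' := Finset.mem_range.mp ha
        rw [Finset.sum_eq_single_of_mem (n - a) (Finset.mem_range.mpr (by omega))
          fun b _ hb => if_neg (by omega), if_pos (by omega)]
    _ = ∑ x ∈ Finset.HasAntidiagonal.antidiagonal n, F x.1 x.2 :=
        (Finset.Nat.sum_antidiagonal_eq_sum_range_succ F n).symm

theorem pd_q_Isad : pd (PVar.q 0) Isad = X (PVar.p 0) := by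
  simp [pd, Isad, pderiv_X]

theorem pd_p_Isad : pd (PVar.p 0) Isad = X (PVar.q 0) := by
  simp [pd, Isad, pderiv_X]

theorem pd_q_X_q : pd (PVar.q 0) (X (PVar.q 0) : Rpoly 1) = 1 := by
  simp [pd]

theorem pd_q_X_p : pd (PVar.q 0) (X (PVar.p 0) : Rpoly 1) = 0 := by
  simp [pd, pderiv_X]

theorem pd_p_X_q : pd (PVar.p 0) (X (PVar.q 0) : Rpoly 1) = 0 := by
  simp [pd, pderiv_X]

theorem pd_p_X_p : pd (PVar.p 0) (X (PVar.p 0) : Rpoly 1) = 1 := by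
  simp [pd]

theorem pd_one {d : ℕ} (v : PVar d) : pd v 1 = 0 := by
  simp [pd]

/-- Every mixed derivative of `I = pq` of order at least three vanishes. -/
theorem pd_pow_pd_pow_Isad {a b : ℕ} (h : 3 ≤ a + b) :
    (pd (PVar.q 0) ^ a) ((pd (PVar.p 0) ^ b) Isad) = 0 := by
  match b with
  | 0 =>
    obtain ⟨c, rfl⟩ : ∃ c, a = c + 2 := ⟨a - 2, by omega⟩
    simp [pow_succ, pd_q_Isad, pd_q_X_p]
  | 1 =>
    obtain ⟨c, rfl⟩ : ∃ c, a = c + 2 := ⟨a - 2, by omega⟩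
    simp [pow_succ, pd_p_Isad, pd_q_X_q, pd_one]
  | b + 2 => simp [pow_succ, pd_p_Isad, pd_p_X_q]

theorem Pop_Isad_eq_zero {k : ℕ} (hk : 3 ≤ k) (B : Rpoly 1) : Pop k Isad B = 0 := by
  rw [Pop_one_dim]
  refine Finset.sum_eq_zero fun x hx => ?_
  rw [pd_pow_pd_pow_Isad (by rw [Finset.HasAntidiagonal.mem_antidiagonal.mp hx]; exact hk)]
  simp

theorem Pop_zero_Isad (B : Rpoly 1) : Pop 0 Isad B = Isad * B := by
  simp [Pop_one_dim]

theorem Pop_one_Isad (B : Rpoly 1) :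
    Pop 1 Isad B =
      X (PVar.p 0) * pd (PVar.p 0) B - X (PVar.q 0) * pd (PVar.q 0) B := by
  simp [Pop_one_dim, Finset.Nat.antidiagonal_succ, pd_q_Isad, pd_p_Isad]
  ring

theorem Pop_two_Isad (B : Rpoly 1) :
    Pop 2 Isad B = -2 * pd (PVar.p 0) (pd (PVar.q 0) B) := by
  simp [Pop_one_dim, Finset.Nat.antidiagonal_succ, pow_succ, pd_q_Isad, pd_p_Isad,
    pd_q_X_q, pd_q_X_p, pd_p_X_q]
  exact Or.inl (map_ofNat C 2)

/-- `I ⋆ B` has only three possibly nonzero terms. -/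
theorem starP_Isad (B : Rpoly 1) :
    starP Isad B = Isad * B +
      C (Complex.I / 2) * hbar 1 *
        (X (PVar.p 0) * pd (PVar.p 0) B - X (PVar.q 0) * pd (PVar.q 0) B) +
      (C (1 / 2 : ℂ) * hbar 1) ^ 2 * pd (PVar.p 0) (pd (PVar.q 0) B) := by
  have hdeg : (Isad).totalDegree = 2 := by
    rw [Isad, totalDegree_mul_of_isDomain (X_ne_zero _) (X_ne_zero _), totalDegree_X,
      totalDegree_X]
  have hsub : Finset.range 3 ⊆ Finset.range ((Isad).totalDegree + B.totalDegree + 1) :=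
    Finset.range_subset_range.mpr (by omega)
  have hI : C (Complex.I / 2) ^ 2 = -(C (1 / 2 : ℂ) ^ 2 : Rpoly 1) := by
    rw [← C_pow, ← C_pow, ← C_neg]
    congr 1
    rw [div_pow, Complex.I_sq]
    ring
  have htwo : (C (1 / 2 : ℂ) : Rpoly 1) * 2 = 1 := by
    rw [← map_ofNat C 2, ← C_mul]
    norm_num
  rw [starP, ← Finset.sum_subset hsub fun k _ hk => by
    rw [Pop_Isad_eq_zero (by simpa using hk), mul_zero]]
  simp only [Finset.sum_range_succ, Finset.sum_range_zero, Pop_zero_Isad, Pop_one_Isad,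
    Pop_two_Isad, Nat.factorial, Nat.cast_one, inv_one, C_1, mul_pow, hI]
  norm_num
  linear_combination
    (C (1 / 2 : ℂ) ^ 2 * hbar 1 ^ 2 * pd (PVar.p 0) (pd (PVar.q 0) B)) * htwo

theorem pd_mul {d : ℕ} (v : PVar d) (A B : Rpoly d) :
    pd v (A * B) = A * pd v B + B * pd v A := by
  simp [pd, Derivation.leibniz]

theorem pd_natCast {d : ℕ} (v : PVar d) (n : ℕ) : pd v (n : Rpoly d) = 0 := by
  simp [pd]

theorem pd_q_Isad_pow (n : ℕ) :
    pd (PVar.q 0) (Isad ^ n) = (n : Rpoly 1) * Isad ^ (n - 1) * X (PVar.p 0) := by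
  rw [← pd_q_Isad]
  simp [pd, Derivation.leibniz_pow, mul_assoc]

theorem pd_p_Isad_pow (n : ℕ) :
    pd (PVar.p 0) (Isad ^ n) = (n : Rpoly 1) * Isad ^ (n - 1) * X (PVar.q 0) := by
  rw [← pd_p_Isad]
  simp [pd, Derivation.leibniz_pow, mul_assoc]

theorem pd_p_pd_q_Isad_pow (n : ℕ) :
    pd (PVar.p 0) (pd (PVar.q 0) (Isad ^ n)) = (n : Rpoly 1) ^ 2 * Isad ^ (n - 1) := by
  rw [pd_q_Isad_pow, pd_mul, pd_mul, pd_natCast, pd_p_Isad_pow, pd_p_X_p]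
  match n with
  | 0 => simp
  | 1 => simp
  | m + 2 =>
    simp only [Nat.add_one_sub_one, pow_succ _ m, Isad]
    push_cast
    ring

/-- Star-product recursion for the saddle integral. For `n ≥ 1`,
`I ⋆ Iⁿ = I^{n+1} + (ħ/2)²·n²·I^{n−1}`. -/
theorem star_recursion_I (n : ℕ) (hn : 1 ≤ n) :
    starP Isad (Isad ^ n) =
      Isad ^ (n + 1) +
        (C (1 / 2 : ℂ) * hbar 1) ^ 2 * C ((n : ℂ) ^ 2) * Isad ^ (n - 1) := by
  rw [starP_Isad, pd_p_pd_q_Isad_pow, pd_q_Isad_pow, pd_p_Isad_pow, C_pow, map_natCast]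
  ring
end
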